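/- arXiv:2205.04084 — 5 statements merged into one kernel-verified Lean document; each statement's English description precedes it below -/
import Mathlib

section
/- Fix x ∈ ℝ with |x| < 1 and define w(y) := Re((1 - (x + iy)²)^{-1/2}) for y > 0, using the principal branch of the complex power. Then w is differentiable on (0, ∞) and lim_{y→0⁺} w'(y) = 0. (This expresses that the harmonic extension of the (1/2)-harmonic function u(x) = (1-x²)^{-1/2}·1_{(-1,1)}(x) has vanishing normal derivative on the segment (-1,1) of the boundary of the upper half-plane.) -/
open Complex Filter Set

theorem one_sub_add_mul_I_sq_mem_slitPlane {x : ℝ} (hx : |x| < 1) (y : ℝ) :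
    1 - ((x : ℂ) + y * I) ^ 2 ∈ slitPlane := by
  refine Or.inl ?_
  have hx2 : x ^ 2 < 1 := (sq_lt_one_iff_abs_lt_one x).2 hx
  have hre : (1 - ((x : ℂ) + y * I) ^ 2).re = 1 - x ^ 2 + y ^ 2 := by
    simp [pow_two]; ring
  rw [hre]
  nlinarith [sq_nonneg y]

theorem hasDerivAt_re_one_sub_add_mul_I_sq_cpow {x : ℝ} (hx : |x| < 1) (c : ℂ) (y : ℝ) :
    HasDerivAt (fun t : ℝ => ((1 - ((x : ℂ) + t * I) ^ 2) ^ c).re)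
      (c * (1 - ((x : ℂ) + y * I) ^ 2) ^ (c - 1) * -(2 * ((x : ℂ) + y * I) * I)).re y := by
  have hz : HasDerivAt (fun t : ℂ => (x : ℂ) + t * I) I (y : ℂ) := by
    simpa using ((hasDerivAt_id (y : ℂ)).mul_const I).const_add (x : ℂ)
  have hb : HasDerivAt (fun t : ℂ => 1 - ((x : ℂ) + t * I) ^ 2)
      (-(2 * ((x : ℂ) + y * I) * I)) (y : ℂ) := by
    simpa using (hz.pow 2).const_sub 1
  exact (hb.cpow_const (one_sub_add_mul_I_sq_mem_slitPlane hx y)).real_of_complex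

/-- for `|x| < 1`, the normal derivative at the boundary of the harmonic
extension `w(y) = Re((1-(x+iy)²)^{-1/2})` vanishes as `y → 0⁺`. -/
theorem normal_derivative_vanishes (x : ℝ) (hx : |x| < 1) :
    (∀ y ∈ Set.Ioi (0:ℝ), DifferentiableAt ℝ
        (fun y' : ℝ => ((1 - ((x:ℂ) + y' * Complex.I) ^ 2) ^ (-(1/2) : ℂ)).re) y) ∧
    Tendsto (deriv (fun y' : ℝ => ((1 - ((x:ℂ) + y' * Complex.I) ^ 2) ^ (-(1/2) : ℂ)).re))
      (nhdsWithin 0 (Set.Ioi 0)) (nhds 0) := by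
  have hd := hasDerivAt_re_one_sub_add_mul_I_sq_cpow hx (-(1/2))
  refine ⟨fun y _ => (hd y).differentiableAt, ?_⟩
  rw [funext fun y => (hd y).deriv]
  have hcont : Continuous fun y : ℝ => (-(1/2) * (1 - ((x : ℂ) + y * I) ^ 2) ^
      (-(1/2) - 1 : ℂ) * -(2 * ((x : ℂ) + y * I) * I)).re := by
    have hpow : Continuous fun y : ℝ => (1 - ((x : ℂ) + y * I) ^ 2) ^ (-(1/2) - 1 : ℂ) :=
      Continuous.cpow (by fun_prop) continuous_const (one_sub_add_mul_I_sq_mem_slitPlane hx)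
    fun_prop
  have hzero : (-(1/2) * (1 - ((x : ℂ) + (0 : ℝ) * I) ^ 2) ^ (-(1/2) - 1 : ℂ) *
      -(2 * ((x : ℂ) + (0 : ℝ) * I) * I)).re = 0 := by
    have hnonneg : 0 ≤ 1 - x ^ 2 := by
      linarith [(sq_lt_one_iff_abs_lt_one x).2 hx]
    have hreal : (1 - ((x : ℂ) + (0 : ℝ) * I) ^ 2) ^ (-(1/2) - 1 : ℂ) =
        (((1 - x ^ 2) ^ (-(1/2) - 1 : ℝ) : ℝ) : ℂ) := by
      rw [ofReal_cpow hnonneg]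
      push_cast
      simp
    have hmul : (-(1/2) * (1 - ((x : ℂ) + (0 : ℝ) * I) ^ 2) ^ (-(1/2) - 1 : ℂ) *
        -(2 * ((x : ℂ) + (0 : ℝ) * I) * I)) =
        (((1 - x ^ 2) ^ (-(1/2) - 1 : ℝ) * x : ℝ) : ℂ) * I := by
      rw [hreal]
      push_cast
      ring
    rw [hmul, re_ofReal_mul, I_re, mul_zero]
  have hlim := hcont.tendsto 0
  rw [hzero] at hlim
  exact hlim.mono_left nhdsWithin_le_nhds
end

section
/- Define u : ℝ → ℝ by u(x) = (1 - x²)^{1/2} for |x| < 1 and u(x) = 0 for |x| ≥ 1. Then for every x ∈ (-1, 1) the principal value (1/π) lim_{ε→0⁺} ∫_{|x-y|>ε} (u(x) - u(y))/(x-y)² dy exists and equals 1. That is, u solves (-Δ)^{1/2} u = 1 in (-1,1) with u = 0 in ℝ \ (-1,1). -/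
open MeasureTheory Filter Set

/-- An antiderivative in `y` of `(√(1 - x²) - √(1 - y²)) / (x - y)²` on `(x, 1)`. -/
noncomputable def semicirclePrimitive (x y : ℝ) : ℝ :=
  (√(1 - y ^ 2) - √(1 - x ^ 2)) / (y - x) + Real.arcsin y
    - x / √(1 - x ^ 2) * (Real.log (1 - x * y + √(1 - x ^ 2) * √(1 - y ^ 2)) - Real.log (y - x))

lemma one_sub_mul_add_sqrt_pos {x y : ℝ} (hx : x ∈ Ioo (-1 : ℝ) 1) (hy : y ∈ Icc (-1 : ℝ) 1) :
    0 < 1 - x * y + √(1 - x ^ 2) * √(1 - y ^ 2) := by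
  obtain ⟨h1, h2⟩ := hx
  obtain ⟨h3, h4⟩ := hy
  have h : 0 < 1 - x * y := by
    rcases le_total 0 y with h | h <;> nlinarith
  positivity

lemma sqrt_one_sub_sq_pos {x : ℝ} (hx : x ∈ Ioo (-1 : ℝ) 1) : 0 < √(1 - x ^ 2) := by
  apply Real.sqrt_pos.2
  nlinarith [hx.1, hx.2]

lemma hasDerivAt_semicirclePrimitive {x y : ℝ} (hx : x ∈ Ioo (-1 : ℝ) 1) (hy : y ∈ Ioo x 1) :
    HasDerivAt (semicirclePrimitive x)
      ((√(1 - x ^ 2) - √(1 - y ^ 2)) / (x - y) ^ 2) y := by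
  have hy' : y ∈ Ioo (-1 : ℝ) 1 := ⟨hx.1.trans hy.1, hy.2⟩
  have ha := sqrt_one_sub_sq_pos hx
  have hu := sqrt_one_sub_sq_pos hy'
  have hpos := one_sub_mul_add_sqrt_pos hx (Ioo_subset_Icc_self hy')
  have hyx : 0 < y - x := sub_pos.2 hy.1
  have ha2 : √(1 - x ^ 2) ^ 2 = 1 - x ^ 2 := Real.sq_sqrt (Real.sqrt_pos.1 ha).le
  have hu2 : √(1 - y ^ 2) ^ 2 = 1 - y ^ 2 := Real.sq_sqrt (Real.sqrt_pos.1 hu).le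
  have hd : HasDerivAt (fun z : ℝ => √(1 - z ^ 2)) (-y / √(1 - y ^ 2)) y := by
    refine (((hasDerivAt_pow 2 y).const_sub 1).sqrt (Real.sqrt_pos.1 hu).ne').congr_deriv ?_
    simp
    field_simp
  have hsub : HasDerivAt (fun z : ℝ => z - x) 1 y := (hasDerivAt_id y).sub_const x
  have hlin : HasDerivAt (fun z : ℝ => 1 - x * z) (-x) y := by
    simpa using ((hasDerivAt_id y).const_mul x).const_sub 1
  have key := (((hd.sub_const (√(1 - x ^ 2))).div hsub hyx.ne').add
    (Real.hasDerivAt_arcsin hy'.1.ne' hy'.2.ne)).sub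
    ((((hlin.add (hd.const_mul (√(1 - x ^ 2)))).log hpos.ne').sub
      (hsub.log hyx.ne')).const_mul (x / √(1 - x ^ 2)))
  refine key.congr_deriv ?_
  simp only [Pi.add_apply]
  generalize √(1 - x ^ 2) = a at *
  generalize √(1 - y ^ 2) = u at *
  have hlog : (-x + a * (-y / u)) / (1 - x * y + a * u) - 1 / (y - x)
      = -a / (u * (y - x)) := by
    rw [div_sub_div _ _ hpos.ne' hyx.ne', div_eq_div_iff (by positivity) (by positivity)]
    field_simp
    linear_combination u * ha2 - a * hu2
  rw [hlog, show (x - y) ^ 2 = (y - x) ^ 2 by ring]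
  field_simp
  ring

lemma continuousOn_semicirclePrimitive {x c : ℝ} (hx : x ∈ Ioo (-1 : ℝ) 1) (hc : x < c) :
    ContinuousOn (semicirclePrimitive x) (Icc c 1) := by
  have h1 : ∀ y ∈ Icc c 1, y - x ≠ 0 := fun y hy => (sub_pos.2 (hc.trans_le hy.1)).ne'
  have h2 : ∀ y ∈ Icc c 1, 1 - x * y + √(1 - x ^ 2) * √(1 - y ^ 2) ≠ 0 := fun y hy =>
    (one_sub_mul_add_sqrt_pos hx ⟨(hx.1.trans (hc.trans_le hy.1)).le, hy.2⟩).ne'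
  unfold semicirclePrimitive
  exact (((by fun_prop : ContinuousOn _ _).div (by fun_prop) h1).add
    Real.continuous_arcsin.continuousOn).sub (continuousOn_const.mul
      (((by fun_prop : ContinuousOn _ _).log h2).sub ((by fun_prop : ContinuousOn _ _).log h1)))

lemma semicirclePrimitive_one {x : ℝ} :
    semicirclePrimitive x 1 = Real.pi / 2 - √(1 - x ^ 2) / (1 - x) := by
  simp [semicirclePrimitive]
  ring

lemma integral_Ioi_semicircle {x c : ℝ} (hx : x ∈ Ioo (-1 : ℝ) 1) (hc : c ∈ Ioo x 1) :
    IntegrableOn (fun y => (√(1 - x ^ 2) - √(1 - y ^ 2)) / (x - y) ^ 2) (Ioi c) ∧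
    ∫ y in Ioi c, (√(1 - x ^ 2) - √(1 - y ^ 2)) / (x - y) ^ 2
      = Real.pi / 2 - semicirclePrimitive x c := by
  set k : ℝ → ℝ := fun y => (√(1 - x ^ 2) - √(1 - y ^ 2)) / (x - y) ^ 2 with hk
  have hcont : ContinuousOn k (Icc c 1) := by
    refine ContinuousOn.div (by fun_prop) (by fun_prop) fun y hy => ?_
    exact pow_ne_zero 2 (sub_neg.2 (hc.1.trans_le hy.1)).ne
  have hkint : IntervalIntegrable k volume c 1 := hcont.intervalIntegrable_of_Icc hc.2.le
  have hbounded : ∫ y in c..1, k y = semicirclePrimitive x 1 - semicirclePrimitive x c :=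
    intervalIntegral.integral_eq_sub_of_hasDerivAt_of_le hc.2.le
      (continuousOn_semicirclePrimitive hx hc.1)
      (fun y hy => hasDerivAt_semicirclePrimitive hx ⟨hc.1.trans hy.1, hy.2⟩) hkint
  have hderiv : ∀ y ∈ Ici (1 : ℝ),
      HasDerivAt (fun z => -√(1 - x ^ 2) / (z - x)) (k y) y := by
    intro y hy
    have hyx : y - x ≠ 0 := (sub_pos.2 (hx.2.trans_le hy)).ne'
    have hu : √(1 - y ^ 2) = 0 := Real.sqrt_eq_zero_of_nonpos (by nlinarith [mem_Ici.1 hy])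
    have h := (hasDerivAt_const y (-√(1 - x ^ 2))).div ((hasDerivAt_id y).sub_const x) hyx
    refine h.congr_deriv ?_
    simp only [hk, hu, id]
    rw [show (x - y) ^ 2 = (y - x) ^ 2 by ring]
    ring
  have hnonneg : ∀ y ∈ Ioi (1 : ℝ), 0 ≤ k y := by
    intro y hy
    have hu : √(1 - y ^ 2) = 0 := Real.sqrt_eq_zero_of_nonpos (by nlinarith [mem_Ioi.1 hy])
    simp only [hk, hu, sub_zero]
    positivity
  have hlim : Tendsto (fun z => -√(1 - x ^ 2) / (z - x)) atTop (nhds 0) :=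
    tendsto_const_nhds.div_atTop (tendsto_atTop_add_const_right _ _ tendsto_id)
  have htail := integrableOn_Ioi_deriv_of_nonneg' hderiv hnonneg hlim
  have htail' := integral_Ioi_of_hasDerivAt_of_nonneg' hderiv hnonneg hlim
  have hIoc : IntegrableOn k (Ioc c 1) :=
    (intervalIntegrable_iff_integrableOn_Ioc_of_le hc.2.le).1 hkint
  rw [← Ioc_union_Ioi_eq_Ioi hc.2.le]
  refine ⟨hIoc.union htail, ?_⟩
  rw [setIntegral_union (Ioc_disjoint_Ioi le_rfl) measurableSet_Ioi hIoc htail, htail',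
    ← intervalIntegral.integral_of_le hc.2.le, hbounded, semicirclePrimitive_one]
  ring

lemma integral_abs_sub_semicircle {x ε : ℝ} (hx : x ∈ Ioo (-1 : ℝ) 1) (hε : 0 < ε)
    (h1 : ε < 1 - x) (h2 : ε < 1 + x) :
    ∫ y in {y : ℝ | ε < |x - y|}, (√(1 - x ^ 2) - √(1 - y ^ 2)) / (x - y) ^ 2
      = Real.pi - (semicirclePrimitive x (x + ε) + semicirclePrimitive (-x) (-x + ε)) := by
  have hset : {y : ℝ | ε < |x - y|} = Iio (x - ε) ∪ Ioi (x + ε) := by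
    ext y
    simp only [mem_ofPred_eq, lt_abs, mem_union, mem_Iio, mem_Ioi]
    constructor <;> rintro (h | h) <;> [left; right; left; right] <;> linarith
  obtain ⟨hi, hI⟩ := integral_Ioi_semicircle hx (c := x + ε) ⟨by linarith, by linarith⟩
  obtain ⟨hi', hI'⟩ := integral_Ioi_semicircle (x := -x) (c := -x + ε)
    ⟨by linarith [hx.2], by linarith [hx.1]⟩ ⟨by linarith, by linarith⟩
  have hreflect : (fun y : ℝ => (√(1 - (-x) ^ 2) - √(1 - y ^ 2)) / (-x - y) ^ 2)
      = fun y => (fun z => (√(1 - x ^ 2) - √(1 - z ^ 2)) / (x - z) ^ 2) (-y) := by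
    ext y
    simp only [neg_sq]
    rw [show (-x - y) ^ 2 = (x - -y) ^ 2 by ring]
  have hc : -(-x + ε) = x - ε := by ring
  have hleft : IntegrableOn (fun y => (√(1 - x ^ 2) - √(1 - y ^ 2)) / (x - y) ^ 2)
      (Iio (x - ε)) := by
    rw [hreflect, ← neg_neg (-x + ε), hc] at hi'
    simpa only [neg_neg] using hi'.comp_neg_Iio
  have hleft' : ∫ y in Iio (x - ε), (√(1 - x ^ 2) - √(1 - y ^ 2)) / (x - y) ^ 2
      = Real.pi / 2 - semicirclePrimitive (-x) (-x + ε) := by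
    rw [hreflect, integral_comp_neg_Ioi (-x + ε)
      (fun z => (√(1 - x ^ 2) - √(1 - z ^ 2)) / (x - z) ^ 2), hc, integral_Iic_eq_integral_Iio] at hI'
    exact hI'
  rw [hset, setIntegral_union _ measurableSet_Ioi hleft hi, hI, hleft']
  · ring
  · exact (Iic_disjoint_Ioi (by linarith)).mono_left Iio_subset_Iic_self

lemma tendsto_semicirclePrimitive_add {x : ℝ} (hx : x ∈ Ioo (-1 : ℝ) 1) :
    Tendsto (fun ε => semicirclePrimitive x (x + ε) + semicirclePrimitive (-x) (-x + ε))
      (nhdsWithin 0 (Ioi 0)) (nhds 0) := by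
  set a := √(1 - x ^ 2) with ha_def
  have ha : 0 < a := sqrt_one_sub_sq_pos hx
  have ha2 : 0 < 1 - x ^ 2 := Real.sqrt_pos.1 ha
  have heq : ∀ ε : ℝ, semicirclePrimitive x (x + ε) + semicirclePrimitive (-x) (-x + ε)
      = ε⁻¹ * (√(1 - (x + ε) ^ 2) + √(1 - (x - ε) ^ 2) - 2 * a)
        + (Real.arcsin (x + ε) - Real.arcsin (x - ε)
        - x / a * (Real.log (1 - x * (x + ε) + a * √(1 - (x + ε) ^ 2))
          - Real.log (1 - x * (x - ε) + a * √(1 - (x - ε) ^ 2)))) := by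
    intro ε
    have e1 : -x + ε = -(x - ε) := by ring
    have e2 : -(x - ε) - -x = ε := by ring
    simp only [semicirclePrimitive, e1, neg_sq, e2, add_sub_cancel_left, Real.arcsin_neg,
      neg_mul_neg, ← ha_def]
    ring
  have hslope : HasDerivAt (fun ε : ℝ => √(1 - (x + ε) ^ 2) + √(1 - (x - ε) ^ 2)) 0 0 := by
    have hp : HasDerivAt (fun ε : ℝ => √(1 - (x + ε) ^ 2)) (-x / a) 0 := by
      have h := ((((hasDerivAt_id (0 : ℝ)).const_add x).pow 2).const_sub 1).sqrt
        (by simpa using ha2.ne')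
      refine h.congr_deriv ?_
      simp [← ha_def]
      field_simp
    have hm : HasDerivAt (fun ε : ℝ => √(1 - (x - ε) ^ 2)) (x / a) 0 := by
      have h := ((((hasDerivAt_id (0 : ℝ)).const_sub x).pow 2).const_sub 1).sqrt
        (by simpa using ha2.ne')
      refine h.congr_deriv ?_
      simp [← ha_def]
      field_simp
    exact (hp.add hm).congr_deriv (by ring)
  have h1 : Tendsto (fun ε : ℝ => ε⁻¹ * (√(1 - (x + ε) ^ 2) + √(1 - (x - ε) ^ 2) - 2 * a))
      (nhdsWithin 0 (Ioi 0)) (nhds 0) := by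
    have h := hslope.tendsto_slope_zero_right
    simpa [← ha_def, two_mul] using h
  have hpos : (1 - x * x + a * √(1 - x ^ 2)) ≠ 0 :=
    (one_sub_mul_add_sqrt_pos hx (Ioo_subset_Icc_self hx)).ne'
  have h2 : ContinuousAt (fun ε : ℝ => Real.arcsin (x + ε) - Real.arcsin (x - ε)
        - x / a * (Real.log (1 - x * (x + ε) + a * √(1 - (x + ε) ^ 2))
          - Real.log (1 - x * (x - ε) + a * √(1 - (x - ε) ^ 2)))) 0 := by
    have hl1 := ContinuousAt.log (f := fun ε : ℝ => 1 - x * (x + ε) + a * √(1 - (x + ε) ^ 2))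
      (a := 0) (by fun_prop) (by simpa using hpos)
    have hl2 := ContinuousAt.log (f := fun ε : ℝ => 1 - x * (x - ε) + a * √(1 - (x - ε) ^ 2))
      (a := 0) (by fun_prop) (by simpa using hpos)
    exact (by fun_prop : ContinuousAt (fun ε : ℝ => Real.arcsin (x + ε) - Real.arcsin (x - ε))
      0).sub (continuousAt_const.mul (hl1.sub hl2))
  have h3 := h1.add (h2.tendsto.mono_left nhdsWithin_le_nhds)
  simp only [heq]
  simpa using h3

lemma ite_one_sub_sq_rpow (y : ℝ) :
    (if |y| < 1 then (1 - y ^ 2) ^ ((1 : ℝ) / 2) else 0) = √(1 - y ^ 2) := by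
  split_ifs with h
  · rw [Real.sqrt_eq_rpow]
  · refine (Real.sqrt_eq_zero_of_nonpos ?_).symm
    have := one_le_sq_iff_one_le_abs y |>.2 (not_lt.1 h)
    linarith

/-- the function `u(x) = (1-x²)^{1/2}` on `(-1,1)`, extended by `0`,
solves `(-Δ)^{1/2} u = 1` in `(-1,1)`. -/
theorem sqrt_solves_fractional_torsion :
    ∀ x ∈ Set.Ioo (-1:ℝ) 1,
      Tendsto (fun ε : ℝ =>
          (1 / Real.pi) * ∫ y in {y : ℝ | ε < |x - y|},
            ((if |x| < 1 then (1 - x^2) ^ ((1:ℝ)/2) else 0)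
              - (if |y| < 1 then (1 - y^2) ^ ((1:ℝ)/2) else 0)) / (x - y) ^ 2)
        (nhdsWithin 0 (Set.Ioi 0)) (nhds 1) := by
  intro x hx
  simp only [ite_one_sub_sq_rpow]
  have hlim := ((tendsto_semicirclePrimitive_add hx).const_sub Real.pi).const_mul (1 / Real.pi)
  rw [sub_zero, one_div_mul_cancel Real.pi_ne_zero] at hlim
  refine hlim.congr' ?_
  have hmin : 0 < min (1 - x) (1 + x) := lt_min (by linarith [hx.2]) (by linarith [hx.1])
  filter_upwards [Ioo_mem_nhdsGT hmin] with ε hε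
  rw [integral_abs_sub_semicircle hx hε.1 (hε.2.trans_le (min_le_left _ _))
    (hε.2.trans_le (min_le_right _ _))]
end

section
/- Fix x ∈ ℝ with |x| < 1 and define w(y) := Re((1 - (x + iy)²)^{1/2} - i(x + iy)) for y > 0, using the principal branch of the complex power. Then w is differentiable on (0, ∞) and lim_{y→0⁺} w'(y) = 1. -/
open Complex Filter Set

theorem one_sub_sq_mem_slitPlane {x : ℝ} (hx : |x| < 1) (y : ℝ) :
    1 - ((x : ℂ) + y * Complex.I) ^ 2 ∈ slitPlane := by
  refine Or.inl ?_
  have h : x ^ 2 < 1 := (sq_lt_one_iff_abs_lt_one x).2 hx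
  have hre : (1 - ((x : ℂ) + y * Complex.I) ^ 2).re = 1 - x ^ 2 + y ^ 2 := by
    simp [pow_two]
    ring
  rw [hre]
  nlinarith [sq_nonneg y]

theorem hasDerivAt_corrected_extension {x : ℝ} (hx : |x| < 1) (y : ℝ) :
    HasDerivAt (fun y' : ℝ =>
        (((1 - ((x : ℂ) + y' * Complex.I) ^ 2) ^ ((1/2) : ℂ)
          - Complex.I * ((x : ℂ) + y' * Complex.I)).re))
      (1 + ((1 - ((x : ℂ) + y * Complex.I) ^ 2) ^ (-(1/2) : ℂ)
        * (-Complex.I * ((x : ℂ) + y * Complex.I))).re) y := by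
  have hz : HasDerivAt (fun w : ℂ => (x : ℂ) + w * Complex.I) Complex.I (y : ℂ) := by
    simpa using ((hasDerivAt_id (y : ℂ)).mul_const Complex.I).const_add (x : ℂ)
  have h := (((hz.pow 2).const_sub 1).cpow_const (c := (1/2 : ℂ))
    (one_sub_sq_mem_slitPlane hx y)).sub (hz.const_mul Complex.I)
  refine h.real_of_complex.congr_deriv ?_
  rw [show (1/2 : ℂ) - 1 = -(1/2) by norm_num, Complex.sub_re, I_mul_I, Complex.neg_re,
    Complex.one_re, sub_neg_eq_add, add_comm]
  congr 2
  simp only [Pi.pow_apply]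
  push_cast
  ring

/-- for `|x| < 1`, the normal derivative at the boundary of the corrected
harmonic extension `w(y) = Re((1-(x+iy)²)^{1/2} - i(x+iy))` tends to `1` as `y → 0⁺`. -/
theorem normal_derivative_equals_one (x : ℝ) (hx : |x| < 1) :
    (∀ y ∈ Set.Ioi (0:ℝ), DifferentiableAt ℝ
        (fun y' : ℝ =>
          (((1 - ((x:ℂ) + y' * Complex.I) ^ 2) ^ ((1/2) : ℂ)
            - Complex.I * ((x:ℂ) + y' * Complex.I)).re)) y) ∧
    Tendsto (deriv (fun y' : ℝ =>
        (((1 - ((x:ℂ) + y' * Complex.I) ^ 2) ^ ((1/2) : ℂ)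
          - Complex.I * ((x:ℂ) + y' * Complex.I)).re)))
      (nhdsWithin 0 (Set.Ioi 0)) (nhds 1) := by
  refine ⟨fun y _ => (hasDerivAt_corrected_extension hx y).differentiableAt, ?_⟩
  rw [funext fun y => (hasDerivAt_corrected_extension hx y).deriv]
  have hcont : Continuous fun y : ℝ =>
      1 + ((1 - ((x : ℂ) + y * Complex.I) ^ 2) ^ (-(1/2) : ℂ)
        * (-Complex.I * ((x : ℂ) + y * Complex.I))).re := by
    have hpow : Continuous fun y : ℝ => (1 - ((x : ℂ) + y * Complex.I) ^ 2) ^ (-(1/2) : ℂ) :=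
      Continuous.cpow (by fun_prop) continuous_const (one_sub_sq_mem_slitPlane hx)
    fun_prop
  refine ((hcont.tendsto' 0 1 ?_).mono_left nhdsWithin_le_nhds)
  have hnonneg : 0 ≤ 1 - x ^ 2 := sub_nonneg.2 ((sq_le_one_iff_abs_le_one x).2 hx.le)
  have hpow : (1 - (x : ℂ) ^ 2) ^ (-(1/2) : ℂ) = (((1 - x ^ 2) ^ (-(1/2) : ℝ) : ℝ) : ℂ) := by
    rw [ofReal_cpow hnonneg]
    push_cast
    rfl
  rw [ofReal_zero, zero_mul, add_zero, hpow, re_ofReal_mul]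
  simp
end

section
/- Let v : ℝ → ℝ be a Schwartz function and for y > 0 define its Poisson (harmonic) extension V(x, y) := ∫_ℝ (y / (π((x - t)² + y²))) v(t) dt. Then for every x ∈ ℝ, lim_{y→0⁺} (v(x) - V(x, y))/y = (1/π) lim_{ε→0⁺} ∫_{|x-t|>ε} (v(x) - v(t))/(x - t)² dt, i.e., the inward normal derivative -∂_y V(x, 0⁺) of the harmonic extension equals (-Δ)^{1/2} v(x). -/
open MeasureTheory Filter Set

namespace SchwartzMap

lemma exists_norm_le {E F : Type*} [NormedAddCommGroup E] [NormedSpace ℝ E]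
    [NormedAddCommGroup F] [NormedSpace ℝ F] (f : SchwartzMap E F) :
    ∃ C : ℝ, 0 ≤ C ∧ ∀ x, ‖f x‖ ≤ C := by
  obtain ⟨C, hC, h⟩ := f.decay 0 0
  exact ⟨C, hC.le, fun x => by simpa using h x⟩

/-- The symmetric second difference of a Schwartz function is at most quadratic in the step. -/
lemma exists_abs_second_difference_le_sq (v : SchwartzMap ℝ ℝ) (x : ℝ) :
    ∃ C : ℝ, 0 ≤ C ∧ ∀ h, |2 * v x - v (x + h) - v (x - h)| ≤ C * h ^ 2 := by
  let v' := derivCLM ℝ ℝ v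
  obtain ⟨C, hC, hb⟩ := (derivCLM ℝ ℝ v').exists_norm_le
  have hd : ∀ y, HasDerivAt v (v' y) y := fun y => v.differentiableAt.hasDerivAt
  have hlip : ∀ a b, ‖v' b - v' a‖ ≤ C * ‖b - a‖ := fun a b =>
    convex_univ.norm_image_sub_le_of_norm_hasDerivWithin_le (f' := derivCLM ℝ ℝ v')
      (fun y _ => v'.differentiableAt.hasDerivAt.hasDerivWithinAt) (fun y _ => hb y)
      (mem_univ a) (mem_univ b)
  refine ⟨2 * C, by positivity, fun h => ?_⟩
  have hD : ∀ s, HasDerivAt (fun s => 2 * v x - v (x + s) - v (x - s))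
      (v' (x - s) - v' (x + s)) s := fun s => by
    have h1 := (hd (x + s)).comp_const_add x s
    have h2 := (hd (x - s)).comp_const_sub x s
    exact ((h1.const_sub (2 * v x)).sub h2).congr_deriv (by ring)
  have hbound : ∀ s ∈ Icc (-|h|) |h|, ‖v' (x - s) - v' (x + s)‖ ≤ 2 * C * |h| := fun s hs => by
    refine (hlip _ _).trans ?_
    have : ‖x - s - (x + s)‖ = 2 * |s| := by
      rw [show x - s - (x + s) = -(2 * s) by ring, norm_neg, Real.norm_eq_abs, abs_mul]
      norm_num
    rw [this]
    nlinarith [mul_le_mul_of_nonneg_left (abs_le.2 hs) hC]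
  have := (convex_Icc (-|h|) |h|).norm_image_sub_le_of_norm_hasDerivWithin_le (x := 0) (y := h)
    (fun s _ => (hD s).hasDerivWithinAt) hbound (by simp)
    (by simp [le_abs_self, neg_le, neg_le_abs h])
  have h0 : 2 * v x - v (x + 0) - v (x - 0) = 0 := by simp; ring
  rwa [h0, sub_zero, sub_zero, Real.norm_eq_abs, Real.norm_eq_abs, mul_assoc, ← sq, sq_abs] at this

/-- Integrals of first differences against an even kernel are half of the integrals of
second differences. -/
lemma integral_even_mul_sub (v : SchwartzMap ℝ ℝ) (x : ℝ) {k : ℝ → ℝ}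
    (hk : Integrable k) (heven : ∀ h, k (-h) = k h) :
    ∫ h, k h * (v x - v (x - h)) =
      (1 / 2) * ∫ h, k h * (2 * v x - v (x + h) - v (x - h)) := by
  obtain ⟨C, -, hC⟩ := v.exists_norm_le
  have hint : Integrable fun h => k h * (v x - v (x - h)) :=
    hk.mul_bdd (c := C + C)
      (by have := v.continuous; exact Continuous.aestronglyMeasurable (by fun_prop))
      (ae_of_all _ fun h => (norm_sub_le _ _).trans (add_le_add (hC _) (hC _)))
  have hneg : ∫ h, k h * (v x - v (x + h)) = ∫ h, k h * (v x - v (x - h)) := by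
    rw [← integral_neg_eq_self fun h => k h * (v x - v (x - h))]
    simp [heven]
  have hint' : Integrable fun h => k h * (v x - v (x + h)) := by
    simpa [heven] using hint.comp_neg
  have : ∫ h, k h * (2 * v x - v (x + h) - v (x - h)) =
      (∫ h, k h * (v x - v (x + h))) + ∫ h, k h * (v x - v (x - h)) := by
    rw [← integral_add hint' hint]
    congr 1 with h
    ring
  rw [this, hneg]
  ring

/-- Integrals of first differences against even integrable kernels increasing to `h⁻²` converge
to the regularized integral of the second difference. -/
lemma tendsto_integral_even_mul_sub (v : SchwartzMap ℝ ℝ) (x : ℝ) {k : ℝ → ℝ → ℝ}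
    (hk : ∀ ε > 0, Integrable (k ε)) (heven : ∀ ε h, k ε (-h) = k ε h)
    (hle : ∀ ε h, h ^ 2 * |k ε h| ≤ 1)
    (hlim : ∀ h ≠ 0, Tendsto (fun ε => k ε h) (nhdsWithin 0 (Ioi 0)) (nhds (h ^ 2)⁻¹)) :
    Tendsto (fun ε => ∫ h, k ε h * (v x - v (x - h))) (nhdsWithin 0 (Ioi 0))
      (nhds ((1 / 2) * ∫ h, (h ^ 2)⁻¹ * (2 * v x - v (x + h) - v (x - h)))) := by
  obtain ⟨A, hA, hAle⟩ := v.exists_abs_second_difference_le_sq x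
  obtain ⟨B, hB, hBle⟩ := v.exists_norm_le
  have hD : ∀ h, |2 * v x - v (x + h) - v (x - h)| ≤ 4 * B := fun h => by
    have h1 := abs_le.1 (hBle x)
    have h2 := abs_le.1 (hBle (x + h))
    have h3 := abs_le.1 (hBle (x - h))
    exact abs_le.2 ⟨by linarith, by linarith⟩
  have heq : ∀ᶠ ε in nhdsWithin (0 : ℝ) (Ioi 0),
      (1 / 2) * ∫ h, k ε h * (2 * v x - v (x + h) - v (x - h)) =
        ∫ h, k ε h * (v x - v (x - h)) := by
    filter_upwards [self_mem_nhdsWithin] with ε hε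
    exact (v.integral_even_mul_sub x (hk ε hε) (heven ε)).symm
  refine Tendsto.congr' heq (Tendsto.const_mul _ ?_)
  refine tendsto_integral_filter_of_dominated_convergence
    (fun h => (A + 4 * B) * (1 + h ^ 2)⁻¹) ?_ ?_ (integrable_inv_one_add_sq.const_mul _) ?_
  · filter_upwards [self_mem_nhdsWithin] with ε hε
    have := v.continuous
    exact (hk ε hε).aestronglyMeasurable.mul (Continuous.aestronglyMeasurable (by fun_prop))
  · refine Eventually.of_forall fun ε => ae_of_all _ fun h => ?_
    rw [← div_eq_mul_inv, le_div_iff₀ (by positivity), norm_mul, Real.norm_eq_abs,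
      Real.norm_eq_abs]
    nlinarith [mul_le_mul_of_nonneg_left (hAle h) (abs_nonneg (k ε h)),
      mul_le_mul_of_nonneg_left (hle ε h) hA,
      mul_le_mul (hle ε h) (hD h) (abs_nonneg _) zero_le_one]
  · filter_upwards [Measure.ae_ne volume (0 : ℝ)] with h hh
    exact (hlim h hh).mul_const _

end SchwartzMap

lemma integrable_indicator_lt_abs_inv_sq {ε : ℝ} (hε : 0 < ε) :
    Integrable ({h : ℝ | ε < |h|}.indicator fun h => (h ^ 2)⁻¹) := by
  have hs : MeasurableSet {h : ℝ | ε < |h|} := measurableSet_lt (by fun_prop) (by fun_prop)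
  refine (integrable_inv_one_add_sq.const_mul (1 + (ε ^ 2)⁻¹)).mono'
    ((by fun_prop : Measurable fun h : ℝ => (h ^ 2)⁻¹).indicator hs).aestronglyMeasurable
    (ae_of_all _ fun h => ?_)
  by_cases hh : ε < |h|
  · have h1 : ε ^ 2 ≤ h ^ 2 := sq_le_sq.2 (by rw [abs_of_pos hε]; exact hh.le)
    have h2 : 0 < h ^ 2 := lt_of_lt_of_le (by positivity) h1
    have h3 : 1 ≤ (ε ^ 2)⁻¹ * h ^ 2 := by
      rw [inv_mul_eq_div]
      exact (one_le_div (by positivity)).2 h1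
    rw [indicator_of_mem (show h ∈ {h : ℝ | ε < |h|} from hh), Real.norm_of_nonneg (by positivity),
      ← div_eq_mul_inv, le_div_iff₀ (by positivity), inv_mul_eq_div, div_le_iff₀ h2]
    linarith
  · rw [indicator_of_notMem (show h ∉ {h : ℝ | ε < |h|} from hh), norm_zero]
    positivity

lemma integrable_inv_sq_add_sq {y : ℝ} (hy : 0 < y) :
    Integrable fun h : ℝ => (h ^ 2 + y ^ 2)⁻¹ := by
  lift y to NNReal using hy.le
  refine ((ProbabilityTheory.integrable_cauchyPDFReal 0 (γ := y)).const_mul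
    (Real.pi * (y : ℝ)⁻¹)).congr (ae_of_all _ fun h => ?_)
  simp only [ProbabilityTheory.cauchyPDFReal_def, sub_zero]
  field_simp

lemma integral_univ_inv_sq_add_sq {y : ℝ} (hy : 0 < y) :
    ∫ h : ℝ, (h ^ 2 + y ^ 2)⁻¹ = Real.pi / y := by
  lift y to NNReal using hy.le
  have := ProbabilityTheory.integral_cauchyPDFReal_eq_one 0 (NNReal.coe_pos.1 hy).ne'
  simp only [ProbabilityTheory.cauchyPDFReal_def, sub_zero, integral_const_mul] at this
  field_simp at this ⊢
  linarith

lemma SchwartzMap.sub_poisson_div_eq (v : SchwartzMap ℝ ℝ) (x : ℝ) {y : ℝ} (hy : 0 < y) :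
    (v x - ∫ t : ℝ, (y / (Real.pi * ((x - t) ^ 2 + y ^ 2))) * v t) / y =
      (1 / Real.pi) * ∫ h, (h ^ 2 + y ^ 2)⁻¹ * (v x - v (x - h)) := by
  obtain ⟨C, -, hC⟩ := v.exists_norm_le
  have hint := integrable_inv_sq_add_sq hy
  have hint' : Integrable fun h => (h ^ 2 + y ^ 2)⁻¹ * v (x - h) :=
    hint.mul_bdd (c := C)
      (by have := v.continuous; exact Continuous.aestronglyMeasurable (by fun_prop))
      (ae_of_all _ fun h => hC _)
  have hP : ∫ t : ℝ, (y / (Real.pi * ((x - t) ^ 2 + y ^ 2))) * v t =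
      y / Real.pi * ∫ h, (h ^ 2 + y ^ 2)⁻¹ * v (x - h) := by
    rw [← integral_const_mul, ← integral_sub_left_eq_self _ volume x]
    congr 1 with h
    rw [sub_sub_cancel, div_mul_eq_div_div, div_eq_mul_inv (y / Real.pi), mul_assoc]
  simp only [mul_sub]
  rw [integral_sub (hint.mul_const _) hint', integral_mul_const, integral_univ_inv_sq_add_sq hy, hP]
  field_simp

/-- Caffarelli–Silvestre identity for `s = 1/2`: the inward normal
derivative of the Poisson extension of a Schwartz function equals its half-Laplacian. -/
theorem poisson_extension_normal_derivative (v : SchwartzMap ℝ ℝ) :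
    ∀ x : ℝ, ∃ L : ℝ,
      Tendsto (fun ε : ℝ =>
          (1 / Real.pi) * ∫ t in {t : ℝ | ε < |x - t|}, (v x - v t) / (x - t) ^ 2)
        (nhdsWithin 0 (Set.Ioi 0)) (nhds L) ∧
      Tendsto (fun y : ℝ =>
          (v x - ∫ t : ℝ, (y / (Real.pi * ((x - t) ^ 2 + y ^ 2))) * v t) / y)
        (nhdsWithin 0 (Set.Ioi 0)) (nhds L) := by
  intro x
  refine ⟨(1 / Real.pi) * ((1 / 2) * ∫ h, (h ^ 2)⁻¹ * (2 * v x - v (x + h) - v (x - h))), ?_, ?_⟩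
  · refine Tendsto.const_mul _ ?_
    have heq : ∀ ε : ℝ, ∫ t in {t : ℝ | ε < |x - t|}, (v x - v t) / (x - t) ^ 2 =
        ∫ h, {h : ℝ | ε < |h|}.indicator (fun h => (h ^ 2)⁻¹) h * (v x - v (x - h)) := fun ε => by
      rw [← integral_indicator (measurableSet_lt (by fun_prop) (by fun_prop)),
        ← integral_sub_left_eq_self _ volume x]
      congr 1 with h
      simp only [indicator_apply, mem_ofPred_eq, sub_sub_cancel, ite_mul, zero_mul,
        inv_mul_eq_div]
    simp only [heq]
    refine v.tendsto_integral_even_mul_sub x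
      (fun ε hε => integrable_indicator_lt_abs_inv_sq hε) ?_ ?_ ?_
    · intro ε h
      simp [indicator_apply]
    · intro ε h
      by_cases hh : ε < |h|
      · simpa [indicator_apply, hh] using mul_inv_le_one (a := h ^ 2)
      · simp [hh]
    · intro h hh
      refine tendsto_const_nhds.congr' ?_
      filter_upwards [nhdsWithin_le_nhds (Iio_mem_nhds (abs_pos.2 hh))] with ε hε
      rw [indicator_of_mem (show h ∈ {h : ℝ | ε < |h|} from hε)]
  · have key := v.tendsto_integral_even_mul_sub x (k := fun y h => (h ^ 2 + y ^ 2)⁻¹)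
      (fun y hy => integrable_inv_sq_add_sq hy) (by simp) ?_ ?_
    · refine (key.const_mul (1 / Real.pi)).congr' ?_
      filter_upwards [self_mem_nhdsWithin] with y hy
      exact (v.sub_poisson_div_eq x hy).symm
    · intro y h
      rw [abs_of_nonneg (by positivity), ← div_eq_mul_inv]
      exact div_le_one_of_le₀ (by nlinarith [sq_nonneg y]) (by positivity)
    · intro h hh
      have : ContinuousAt (fun y : ℝ => (h ^ 2 + y ^ 2)⁻¹) 0 :=
        ContinuousAt.inv₀ (by fun_prop) (by simpa using hh)
      simpa using this.tendsto.mono_left nhdsWithin_le_nhds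
end

section
/- Let v : ℝ → ℝ be a Schwartz function. Then for every ξ ∈ ℝ, the Fourier transform of the function x ↦ (1/π) lim_{ε→0⁺} ∫_{|x-t|>ε} (v(x) - v(t))/(x - t)² dt evaluated at ξ equals |ξ| · v̂(ξ), where v̂ denotes the Fourier transform of v. That is, the Fourier symbol of (-Δ)^{1/2} on ℝ is |ξ|. -/
open MeasureTheory Filter Set Complex

theorem one_sub_cos_mul_exp_eq_re (t y : ℝ) :
    (1 - Real.cos y) * Real.exp (-t * y) =
      RCLike.re (Complex.exp (-(t : ℂ) * y) - Complex.exp ((-(t : ℂ) + I) * y)) := by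
  simp [Complex.exp_re]
  ring

theorem integrableOn_one_sub_cos_mul_exp {t : ℝ} (ht : 0 < t) :
    IntegrableOn (fun y : ℝ => (1 - Real.cos y) * Real.exp (-t * y)) (Ioi 0) := by
  simp_rw [one_sub_cos_mul_exp_eq_re]
  exact ((integrableOn_exp_mul_complex_Ioi (a := -(t : ℂ)) (by simpa) 0).sub
    (integrableOn_exp_mul_complex_Ioi (a := -(t : ℂ) + I) (by simpa) 0)).re

theorem integral_one_sub_cos_mul_exp {t : ℝ} (ht : 0 < t) :
    ∫ y in Ioi (0 : ℝ), t * ((1 - Real.cos y) * Real.exp (-t * y)) = (1 + t ^ 2)⁻¹ := by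
  have h₁ := integrableOn_exp_mul_complex_Ioi (a := -(t : ℂ)) (by simpa) 0
  have h₂ := integrableOn_exp_mul_complex_Ioi (a := -(t : ℂ) + I) (by simpa) 0
  rw [integral_const_mul]
  simp_rw [one_sub_cos_mul_exp_eq_re]
  have hre := integral_re (h₁.sub h₂)
  simp only [Pi.sub_apply] at hre
  rw [hre, integral_sub h₁ h₂,
    integral_exp_mul_complex_Ioi (by simpa), integral_exp_mul_complex_Ioi (by simpa)]
  simp [Complex.div_re, Complex.normSq_apply]
  field_simp
  ring

theorem integral_mul_exp_neg_mul_Ioi {y : ℝ} (hy : 0 < y) :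
    ∫ t in Ioi (0 : ℝ), t * Real.exp (-t * y) = 1 / y ^ 2 := by
  have h := Real.integral_rpow_mul_exp_neg_mul_Ioi (a := 2) two_pos hy
  norm_num at h
  rw [← one_div] at h
  rw [← h]
  refine integral_congr_ae (ae_of_all _ fun t => ?_)
  simp [mul_comm]

/-- `∫_ℝ (1 - cos y) / y² dy = π`. -/
theorem integral_one_sub_cos_div_sq : ∫ y : ℝ, (1 - Real.cos y) / y ^ 2 = Real.pi := by
  have habs := integral_comp_abs (f := fun y : ℝ => (1 - Real.cos y) / y ^ 2)
  simp only [Real.cos_abs, sq_abs] at habs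
  rw [habs]
  let H : ℝ → ℝ → ℝ := fun t y => t * ((1 - Real.cos y) * Real.exp (-t * y))
  have hmeas : AEStronglyMeasurable (Function.uncurry H)
      ((volume.restrict (Ioi 0)).prod (volume.restrict (Ioi 0))) := by
    apply Continuous.aestronglyMeasurable
    simp only [H, Function.uncurry_def]
    fun_prop
  have hint : Integrable (Function.uncurry H)
      ((volume.restrict (Ioi 0)).prod (volume.restrict (Ioi 0))) := by
    rw [integrable_prod_iff hmeas]
    refine ⟨(ae_restrict_iff' measurableSet_Ioi).2 (ae_of_all _ fun t ht =>
      (integrableOn_one_sub_cos_mul_exp ht).const_mul t), ?_⟩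
    refine (integrable_inv_one_add_sq.integrableOn (s := Ioi 0)).congr_fun_ae ?_
    refine (ae_restrict_iff' measurableSet_Ioi).2 (ae_of_all _ fun t ht => ?_)
    refine (integral_one_sub_cos_mul_exp ht).symm.trans ?_
    refine integral_congr_ae (ae_of_all _ fun y => ?_)
    have h₁ := Real.cos_le_one y
    have ht' : 0 < t := ht
    exact (Real.norm_of_nonneg (by have := sub_nonneg.2 h₁; positivity)).symm
  have hswap := integral_integral_swap hint
  have hleft : ∫ t in Ioi (0 : ℝ), ∫ y in Ioi (0 : ℝ), H t y = Real.pi / 2 := by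
    rw [setIntegral_congr_fun measurableSet_Ioi
      fun t ht => integral_one_sub_cos_mul_exp ht, integral_Ioi_inv_one_add_sq]
    simp
  have hright : ∫ y in Ioi (0 : ℝ), ∫ t in Ioi (0 : ℝ), H t y =
      ∫ y in Ioi (0 : ℝ), (1 - Real.cos y) / y ^ 2 := by
    refine setIntegral_congr_fun measurableSet_Ioi fun y hy => ?_
    have h := integral_mul_exp_neg_mul_Ioi hy
    simp only [H]
    rw [div_eq_mul_one_div, ← h, ← integral_const_mul]
    exact integral_congr_ae (ae_of_all _ fun t => by ring)
  rw [← hright, ← hswap, hleft]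
  ring

theorem integral_two_sub_two_cos_mul_div_sq (ξ : ℝ) :
    ∫ y : ℝ, (2 - 2 * Real.cos (ξ * y)) / y ^ 2 = 2 * Real.pi * |ξ| := by
  rcases eq_or_ne ξ 0 with rfl | hξ
  · simp
  have h := Measure.integral_comp_mul_left (fun y : ℝ => (1 - Real.cos y) / y ^ 2) ξ
  rw [integral_one_sub_cos_div_sq, smul_eq_mul, abs_inv] at h
  have hcongr : ∀ y : ℝ, (2 - 2 * Real.cos (ξ * y)) / y ^ 2 =
      2 * ξ ^ 2 * ((1 - Real.cos (ξ * y)) / (ξ * y) ^ 2) := fun y => by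
    field_simp
  simp_rw [hcongr]
  rw [integral_const_mul, h, ← sq_abs]
  field_simp

theorem measurableSet_lt_abs (ε : ℝ) : MeasurableSet {y : ℝ | ε < |y|} :=
  measurableSet_lt measurable_const measurable_id.abs

theorem integrableOn_one_div_sq {ε : ℝ} (hε : 0 < ε) :
    IntegrableOn (fun y : ℝ => 1 / y ^ 2) {y | ε < |y|} := by
  refine ((integrable_inv_one_add_sq.const_mul (1 + 1 / ε ^ 2)).integrableOn).mono'
    (Measurable.aestronglyMeasurable (by fun_prop))
    ((ae_restrict_iff' (measurableSet_lt_abs ε)).2 (ae_of_all _ fun y hy => ?_))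
  have hsq : ε ^ 2 < y ^ 2 := by
    rw [← sq_abs y]
    exact pow_lt_pow_left₀ hy hε.le two_ne_zero
  have hε2 : 0 < ε ^ 2 := by positivity
  have hy2 : 0 < y ^ 2 := hε2.trans hsq
  rw [Real.norm_of_nonneg (by positivity), ← div_eq_mul_inv, div_le_div_iff₀ hy2 (by positivity)]
  have : 1 ≤ 1 / ε ^ 2 * y ^ 2 := by
    rw [one_div_mul_eq_div, one_le_div hε2]
    exact hsq.le
  linarith

theorem tendsto_setIntegral_lt_abs {f : ℝ → ℝ} (hf : Integrable f) :
    Tendsto (fun ε : ℝ => ∫ y in {y : ℝ | ε < |y|}, f y) (nhdsWithin 0 (Ioi 0))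
      (nhds (∫ y, f y)) := by
  simp_rw [← integral_indicator (measurableSet_lt_abs _)]
  refine tendsto_integral_filter_of_dominated_convergence (fun y => ‖f y‖)
    (Eventually.of_forall fun ε =>
      hf.aestronglyMeasurable.indicator (measurableSet_lt_abs ε))
    (Eventually.of_forall fun ε => ae_of_all _ fun y => norm_indicator_le_norm_self _ _)
    hf.norm ?_
  filter_upwards [Measure.ae_ne volume (0 : ℝ)] with y hy
  refine tendsto_const_nhds.congr' ?_
  filter_upwards [mem_nhdsWithin_of_mem_nhds (Iio_mem_nhds (abs_pos.2 hy))] with ε hε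
  exact (indicator_of_mem (s := {y : ℝ | ε < |y|}) hε f).symm

namespace SchwartzMap

variable (v : SchwartzMap ℝ ℝ)

theorem exists_abs_le_div_one_add_sq :
    ∃ C, 0 ≤ C ∧ ∀ x, |v x| ≤ C / (1 + x ^ 2) := by
  obtain ⟨C₀, h₀, hC₀⟩ := v.decay 0 0
  obtain ⟨C₂, h₂, hC₂⟩ := v.decay 2 0
  refine ⟨C₀ + C₂, by positivity, fun x => ?_⟩
  have h := hC₀ x
  have h' := hC₂ x
  simp at h h'
  rw [le_div_iff₀ (by positivity)]
  linarith

theorem abs_second_difference_le {x y M : ℝ} (hM : 0 ≤ M)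
    (h : ∀ z ∈ Icc (x - |y|) (x + |y|), |deriv (deriv v) z| ≤ M) :
    |2 * v x - v (x + y) - v (x - y)| ≤ 2 * M * y ^ 2 := by
  have hd : ∀ z, HasDerivAt (deriv v) (deriv (deriv v) z) z :=
    (SchwartzMap.derivCLM ℝ ℝ v).hasDerivAt
  have hfirst : ∀ s ∈ Icc (-|y|) |y|, |deriv v (x + s) - deriv v (x - s)| ≤ 2 * M * |y| := by
    intro s hs
    have := (convex_Icc (x - |y|) (x + |y|)).norm_image_sub_le_of_norm_hasDerivWithin_le
      (f := deriv v) (fun z _ => (hd z).hasDerivWithinAt) h (x := x - s) (y := x + s)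
      (by constructor <;> linarith [hs.1, hs.2]) (by constructor <;> linarith [hs.1, hs.2])
    rw [Real.norm_eq_abs, Real.norm_eq_abs] at this
    refine this.trans ?_
    have h2 : |x + s - (x - s)| ≤ 2 * |y| := by
      rw [abs_le]
      constructor <;> linarith [hs.1, hs.2]
    calc M * |x + s - (x - s)| ≤ M * (2 * |y|) := by gcongr
      _ = _ := by ring
  have hφ : ∀ s, HasDerivAt (fun s => v (x + s) + v (x - s))
      (deriv v (x + s) - deriv v (x - s)) s := fun s => by
    have h₁ := (v.hasDerivAt (x + s)).comp_const_add x s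
    have h₂ := (v.hasDerivAt (x - s)).comp_const_sub x s
    exact (h₁.add h₂).congr_deriv (sub_eq_add_neg _ _).symm
  have := (convex_Icc (-|y|) |y|).norm_image_sub_le_of_norm_hasDerivWithin_le
    (f := fun s => v (x + s) + v (x - s)) (fun z _ => (hφ z).hasDerivWithinAt) hfirst
    (x := 0) (y := y) (by simp) ⟨neg_abs_le y, le_abs_self y⟩
  simp only [Real.norm_eq_abs, add_zero, sub_zero] at this
  rw [← abs_neg]
  calc _ = |v (x + y) + v (x - y) - (v x + v x)| := by congr 1; ring
    _ ≤ _ := this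
    _ = 2 * M * |y| ^ 2 := by ring
    _ = _ := by rw [sq_abs]

theorem exists_abs_second_difference_le :
    ∃ C, ∀ x y, |y| ≤ 1 →
      |2 * v x - v (x + y) - v (x - y)| ≤ C * (1 + x ^ 2)⁻¹ * y ^ 2 := by
  obtain ⟨C, hC, h⟩ :=
    (SchwartzMap.derivCLM ℝ ℝ (SchwartzMap.derivCLM ℝ ℝ v)).exists_abs_le_div_one_add_sq
  refine ⟨6 * C, fun x y hy => ?_⟩
  refine (v.abs_second_difference_le (M := 3 * C * (1 + x ^ 2)⁻¹) (by positivity)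
    fun z hz => (h z).trans ?_).trans_eq (by ring)
  rw [← div_eq_mul_inv, div_le_div_iff₀ (by positivity) (by positivity)]
  have h1 : (x - z) ^ 2 ≤ 1 := by
    rw [sq_le_one_iff_abs_le_one, abs_le]
    constructor <;> linarith [hz.1, hz.2]
  have : 1 + x ^ 2 ≤ 3 * (1 + z ^ 2) := by nlinarith [sq_nonneg (x - 2 * z)]
  nlinarith

theorem integrable_second_difference_quotient :
    Integrable (fun p : ℝ × ℝ => (2 * v p.1 - v (p.1 + p.2) - v (p.1 - p.2)) / p.2 ^ 2)
      (volume.prod volume) := by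
  obtain ⟨C, hC⟩ := v.exists_abs_second_difference_le
  have hv := v.continuous.measurable
  let k : ℝ → ℝ := {y : ℝ | 1 < |y|}.indicator fun y => 1 / y ^ 2
  have hk : Integrable k :=
    (integrableOn_one_div_sq one_pos).integrable_indicator (measurableSet_lt_abs 1)
  have hb : Integrable ((Icc (-1 : ℝ) 1).indicator fun _ => (1 : ℝ)) :=
    (integrable_indicator_iff measurableSet_Icc).2 (by simp)
  have hnear := (integrable_inv_one_add_sq.const_mul C).mul_prod hb
  have hmid := (v.integrable (μ := volume)).mul_prod hk
  have hminus := hk.convolution_integrand (ContinuousLinearMap.mul ℝ ℝ)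
    (v.integrable (μ := volume))
  have hplus := (((MeasurePreserving.id (volume : Measure ℝ)).prod
    (Measure.measurePreserving_neg (volume : Measure ℝ))).integrable_comp
      hminus.aestronglyMeasurable).2 hminus
  refine (hnear.norm.add ((hmid.norm.const_mul 2).add (hplus.norm.add hminus.norm))).mono'
    (Measurable.aestronglyMeasurable (by fun_prop)) (ae_of_all _ fun ⟨x, y⟩ => ?_)
  have hkneg : k (-y) = k y := by simp [k, indicator]
  simp only [Pi.add_apply, Function.comp_apply, Prod.map_apply, id_eq, hkneg,
    ContinuousLinearMap.mul_apply', sub_neg_eq_add]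
  rcases le_or_gt |y| 1 with hy | hy
  · have hmem : y ∈ Icc (-1 : ℝ) 1 := abs_le.1 hy
    refine le_trans ?_ (le_add_of_nonneg_right (by positivity))
    rw [indicator_of_mem hmem, mul_one, norm_div, Real.norm_eq_abs, norm_pow, Real.norm_eq_abs y,
      sq_abs]
    exact div_le_of_le_mul₀ (by positivity) (by positivity)
      ((hC x y hy).trans (by gcongr; exact le_abs_self _))
  · refine le_trans ?_ (le_add_of_nonneg_left (by positivity))
    have hky : k y = 1 / y ^ 2 := indicator_of_mem (s := {y : ℝ | 1 < |y|}) hy _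
    rw [hky]
    simp only [norm_mul, norm_div, norm_one, norm_pow, Real.norm_eq_abs, sq_abs]
    have : |2 * v x - v (x + y) - v (x - y)| ≤ 2 * |v x| + |v (x + y)| + |v (x - y)| := by
      refine (abs_sub _ _).trans ?_
      gcongr
      refine (abs_sub _ _).trans ?_
      simp [abs_mul]
    calc _ ≤ (2 * |v x| + |v (x + y)| + |v (x - y)|) / y ^ 2 := by gcongr
      _ = _ := by ring

theorem setIntegral_difference_quotient_eq {ε : ℝ} (hε : 0 < ε) (x : ℝ) :
    ∫ t in {t : ℝ | ε < |x - t|}, (v x - v t) / (x - t) ^ 2 =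
      (∫ y in {y : ℝ | ε < |y|}, (2 * v x - v (x + y) - v (x - y)) / y ^ 2) / 2 := by
  have hS := measurableSet_lt_abs ε
  have hv := v.continuous.measurable
  let q : ℝ → ℝ := {y : ℝ | ε < |y|}.indicator fun y => (v x - v (x - y)) / y ^ 2
  have hq : Integrable q := by
    obtain ⟨C, h₀, hC⟩ := v.decay 0 0
    refine IntegrableOn.integrable_indicator ?_ hS
    refine ((integrableOn_one_div_sq hε).const_mul (2 * C)).mono'
      (Measurable.aestronglyMeasurable (by fun_prop)) (ae_of_all _ fun y => ?_)
    have h₁ := hC x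
    have h₂ := hC (x - y)
    simp at h₁ h₂
    rw [norm_div, norm_pow, Real.norm_eq_abs, Real.norm_eq_abs, sq_abs, mul_one_div]
    gcongr
    exact (abs_sub _ _).trans (by linarith)
  have hleft : ∫ t in {t : ℝ | ε < |x - t|}, (v x - v t) / (x - t) ^ 2 = ∫ y, q y := by
    have hT : MeasurableSet {t : ℝ | ε < |x - t|} :=
      measurableSet_lt measurable_const (measurable_const.sub measurable_id).abs
    rw [← integral_indicator hT, ← integral_sub_left_eq_self q volume x]
    refine integral_congr_ae (ae_of_all _ fun t => ?_)
    simp [q, indicator]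
  have hright : ∫ y in {y : ℝ | ε < |y|}, (2 * v x - v (x + y) - v (x - y)) / y ^ 2 =
      (∫ y, q y) + ∫ y, q (-y) := by
    rw [← integral_indicator hS, ← integral_add hq hq.comp_neg]
    refine integral_congr_ae (ae_of_all _ fun y => ?_)
    simp only [q, indicator, mem_ofPred_eq, abs_neg]
    split_ifs
    · rw [sub_neg_eq_add, neg_sq]
      ring
    · simp
  rw [hleft, hright, integral_neg_eq_self]
  ring

theorem fourier_second_difference_quotient (ξ y : ℝ) :
    ∫ x : ℝ, Complex.exp (-(Complex.I * ξ * x)) *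
        (((2 * v x - v (x + y) - v (x - y)) / y ^ 2 : ℝ) : ℂ) =
      (((2 - 2 * Real.cos (ξ * y)) / y ^ 2 : ℝ) : ℂ) *
        ∫ x : ℝ, Complex.exp (-(Complex.I * ξ * x)) * (v x : ℂ) := by
  let e : ℝ → ℂ := fun x => Complex.exp (-(Complex.I * ξ * x))
  let f : ℝ → ℂ := fun x => e x * (v x : ℂ)
  have hf : Integrable f := by
    refine (v.integrable (μ := volume)).ofReal.bdd_mul (c := 1)
      (Continuous.aestronglyMeasurable (by fun_prop)) (ae_of_all _ fun x => ?_)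
    simp [e, Complex.norm_exp]
  have hpt : ∀ x, e x * (((2 * v x - v (x + y) - v (x - y)) / y ^ 2 : ℝ) : ℂ) =
      ((y : ℂ) ^ 2)⁻¹ * (2 * f x - Complex.exp (Complex.I * ξ * y) * f (x + y) -
        Complex.exp (-(Complex.I * ξ * y)) * f (x - y)) := fun x => by
    have h₁ : Complex.exp (Complex.I * ξ * y) * e (x + y) = e x := by
      simp only [e, ← Complex.exp_add]
      congr 1
      push_cast
      ring
    have h₂ : Complex.exp (-(Complex.I * ξ * y)) * e (x - y) = e x := by
      simp only [e, ← Complex.exp_add]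
      congr 1
      push_cast
      ring
    simp only [f, ← mul_assoc, h₁, h₂]
    push_cast
    ring
  have hcos : Complex.exp (Complex.I * ξ * y) + Complex.exp (-(Complex.I * ξ * y)) =
      2 * Complex.cos (ξ * y) := by
    rw [Complex.two_cos]
    congr 2 <;> ring
  change ∫ x, e x * _ = _ * ∫ x, f x
  simp_rw [hpt]
  rw [integral_const_mul, integral_sub, integral_sub, integral_const_mul, integral_const_mul,
    integral_const_mul, integral_add_right_eq_self f, integral_sub_right_eq_self f]
  · push_cast
    linear_combination (-((y : ℂ) ^ 2)⁻¹ * ∫ x, f x) * hcos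
  · exact hf.const_mul _
  · exact (hf.comp_add_right y).const_mul _
  · exact (hf.const_mul _).sub ((hf.comp_add_right y).const_mul _)
  · exact (hf.comp_sub_right y).const_mul _

end SchwartzMap

/-- the Fourier symbol of `(-Δ)^{1/2}` on `ℝ` is `|ξ|`: if `g` is the
pointwise principal-value half-Laplacian of a Schwartz function `v`, then
`ĝ(ξ) = |ξ|·v̂(ξ)` (with the convention `v̂(ξ) = ∫ e^{-iξx} v(x) dx`). -/
theorem fourier_symbol_half_laplacian (v : SchwartzMap ℝ ℝ) (g : ℝ → ℝ)
    (hg : ∀ x : ℝ,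
      Tendsto (fun ε : ℝ =>
          (1 / Real.pi) * ∫ t in {t : ℝ | ε < |x - t|}, (v x - v t) / (x - t) ^ 2)
        (nhdsWithin 0 (Set.Ioi 0)) (nhds (g x))) :
    ∀ ξ : ℝ,
      (∫ x : ℝ, Complex.exp (-(Complex.I * ξ * x)) * (g x : ℂ))
        = (|ξ| : ℝ) * ∫ x : ℝ, Complex.exp (-(Complex.I * ξ * x)) * (v x : ℂ) := by
  intro ξ
  have hint := v.integrable_second_difference_quotient
  let F : ℝ → ℝ → ℝ := fun x y => (2 * v x - v (x + y) - v (x - y)) / y ^ 2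
  have hgF : ∀ᵐ x : ℝ, g x = 1 / (2 * Real.pi) * ∫ y, F x y := by
    filter_upwards [hint.prod_right_ae] with x hx
    refine tendsto_nhds_unique (hg x) (((tendsto_setIntegral_lt_abs hx).const_mul
      (1 / (2 * Real.pi))).congr' ?_)
    filter_upwards [self_mem_nhdsWithin] with ε hε
    rw [v.setIntegral_difference_quotient_eq hε x]
    field_simp
  have hexp : Integrable (Function.uncurry fun x y : ℝ =>
      Complex.exp (-(Complex.I * ξ * x)) * (F x y : ℂ)) (volume.prod volume) := by
    refine hint.ofReal.bdd_mul (c := 1) (Continuous.aestronglyMeasurable (by fun_prop))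
      (ae_of_all _ fun x => ?_)
    simp [Complex.norm_exp]
  calc _ = ∫ x : ℝ, (1 / (2 * Real.pi) : ℂ) *
        ∫ y : ℝ, Complex.exp (-(Complex.I * ξ * x)) * (F x y : ℂ) := by
        refine integral_congr_ae ?_
        filter_upwards [hgF] with x hx
        rw [hx, integral_const_mul, integral_complex_ofReal]
        push_cast
        ring
    _ = (1 / (2 * Real.pi) : ℂ) *
        ∫ y : ℝ, ∫ x : ℝ, Complex.exp (-(Complex.I * ξ * x)) * (F x y : ℂ) := by
        rw [integral_const_mul, integral_integral_swap hexp]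
    _ = _ := by
        simp only [F, v.fourier_second_difference_quotient]
        rw [integral_mul_const, integral_complex_ofReal, integral_two_sub_two_cos_mul_div_sq]
        have hpi : (Real.pi : ℂ) ≠ 0 := by exact_mod_cast Real.pi_ne_zero
        push_cast
        field_simp
end
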